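/- arXiv:1611.02425 — 4 statements merged into one kernel-verified Lean document; each statement's English description precedes it below -/
import Mathlib

section
/- Let a_1, …, a_N, b_1, …, b_N, and c_1, …, c_N be real numbers, with pointwise products ab, bc, abc. Then S_a · Δ · S_b · Δ · S_c + S_{ab} · Δ · S_c + S_a · Δ · S_{bc} + S_{abc} = S_a · S_b · S_c, where Δ is the N×N shift matrix with Δ_{i,j} = 1 if i = j + 1 and 0 otherwise. -/
open Finset Matrix

/-- The `N × N` index matrix of the sequence `a`: entry `(i,j)` (1-based) is `a i` if `i ≥ j`,
else `0`. Here `i : Fin N` corresponds to the 1-based index `i + 1`. -/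
noncomputable def idxS (N : ℕ) (a : ℕ → ℝ) : Matrix (Fin N) (Fin N) ℝ :=
  Matrix.of fun i j => if (j : ℕ) ≤ (i : ℕ) then a ((i : ℕ) + 1) else 0

/-- The `N × N` shift matrix `Δ`, with `Δ_{i,j} = 1` if `i = j + 1` and `0` otherwise. -/
noncomputable def shiftM (N : ℕ) : Matrix (Fin N) (Fin N) ℝ :=
  Matrix.of fun i j => if (i : ℕ) = (j : ℕ) + 1 then (1 : ℝ) else 0

theorem idxS_mul_shiftM (N : ℕ) (a : ℕ → ℝ) :
    idxS N a * shiftM N = idxS N a - diagonal fun i : Fin N => a ((i : ℕ) + 1) := by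
  ext i j
  have hi := i.isLt
  simp only [idxS, shiftM, Matrix.mul_apply, Matrix.of_apply, Matrix.sub_apply,
    Matrix.diagonal_apply, Fin.ext_iff]
  by_cases hj : (j : ℕ) + 1 < N
  · rw [Finset.sum_eq_single (⟨(j : ℕ) + 1, hj⟩ : Fin N)]
    · simp only [if_true, mul_one]
      split_ifs <;> first | omega | simp
    · intro k _ hk
      rw [if_neg (fun h => hk (Fin.ext h)), mul_zero]
    · simp
  · rw [Finset.sum_eq_zero]
    · split_ifs <;> first | omega | simp
    · intro k _
      rw [if_neg (by omega : ¬ (k : ℕ) = (j : ℕ) + 1), mul_zero]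

theorem diagonal_mul_idxS (N : ℕ) (a b : ℕ → ℝ) :
    (diagonal fun i : Fin N => a ((i : ℕ) + 1)) * idxS N b = idxS N fun n => a n * b n := by
  ext i j
  simp [idxS, Matrix.diagonal_mul]

theorem stmt_5 (N : ℕ) (a b c : ℕ → ℝ) :
    idxS N a * shiftM N * idxS N b * shiftM N * idxS N c
        + idxS N (fun n => a n * b n) * shiftM N * idxS N c
        + idxS N a * shiftM N * idxS N (fun n => b n * c n)
        + idxS N (fun n => a n * b n * c n)
      = idxS N a * idxS N b * idxS N c := by
  have hab := diagonal_mul_idxS N a b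
  have hbc := diagonal_mul_idxS N b c
  have habc := diagonal_mul_idxS N (fun n => a n * b n) c
  have hdiag : (diagonal fun i : Fin N => a ((i : ℕ) + 1) * b ((i : ℕ) + 1)) =
      (diagonal fun i : Fin N => a ((i : ℕ) + 1)) * diagonal fun i : Fin N => b ((i : ℕ) + 1) := by
    rw [Matrix.diagonal_mul_diagonal]
  rw [Matrix.mul_assoc (idxS N a * shiftM N) (idxS N b) (shiftM N)]
  simp only [idxS_mul_shiftM]
  rw [← habc, ← hab, ← hbc, hdiag]
  noncomm_ring
end

section
/- Let a_1, …, a_N be pairwise distinct nonzero real numbers. Define the N×N lower-triangular matrix D_a by d_{i,j} = (a_i/a_N) · ∏_{k=i+1}^{N} (1 − a_k/a_j) for i ≥ j and d_{i,j} = 0 for i < j. Then for each j ∈ {1, …, N}, the j-th column of D_a is an eigenvector of the index matrix S_a with eigenvalue a_j; equivalently, S_a · D_a = D_a · diag(a_1, …, a_N). -/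
open Finset Matrix

/-- The eigenvector matrix `D_a`: for 1-based indices `i ≥ j`,
`d_{i,j} = (a_i / a_N) ∏_{k=i+1}^N (1 - a_k / a_j)`, and `0` otherwise. -/
noncomputable def Dmat (N : ℕ) (a : ℕ → ℝ) : Matrix (Fin N) (Fin N) ℝ :=
  Matrix.of fun i j =>
    if (j : ℕ) ≤ (i : ℕ) then
      (a ((i : ℕ) + 1) / a N) * ∏ k ∈ Finset.Icc ((i : ℕ) + 2) N, (1 - a k / a ((j : ℕ) + 1))
    else 0

/-- Partial sums of the unnormalised column entries telescope. -/
theorem sum_mul_prod_one_sub_div (N : ℕ) (a : ℕ → ℝ) (j : ℕ) (hj : a (j + 1) ≠ 0)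
    (i : ℕ) (hji : j ≤ i) (hi : i < N) :
    ∑ m ∈ Finset.Icc j i, a (m + 1) * ∏ k ∈ Finset.Icc (m + 2) N, (1 - a k / a (j + 1)) =
      a (j + 1) * ∏ k ∈ Finset.Icc (i + 2) N, (1 - a k / a (j + 1)) := by
  induction i, hji using Nat.le_induction with
  | base => simp
  | succ i hji ih =>
    rw [Finset.sum_Icc_succ_top (by omega), ih (by omega),
      ← Finset.mul_prod_Ioc_eq_prod_Icc (show i + 2 ≤ N by omega)]
    have hIoc : Finset.Ioc (i + 2) N = Finset.Icc (i + 1 + 2) N := by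
      ext k
      simp only [Finset.mem_Ioc, Finset.mem_Icc]
      omega
    rw [hIoc]
    field_simp
    ring

theorem stmt_7 (N : ℕ) (a : ℕ → ℝ)
    (hdist : Set.InjOn a (Set.Icc 1 N)) (hne : ∀ n ∈ Finset.Icc 1 N, a n ≠ 0) :
    idxS N a * Dmat N a = Dmat N a * Matrix.diagonal (fun i : Fin N => a ((i : ℕ) + 1)) := by
  ext i j
  have hj : a ((j : ℕ) + 1) ≠ 0 := hne _ (by simp only [Finset.mem_Icc]; omega)
  rw [Matrix.mul_diagonal, Matrix.mul_apply]
  simp only [idxS, Dmat, Matrix.of_apply]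
  have hsum := Fin.sum_univ_eq_sum_range (fun m : ℕ =>
    (if m ≤ (i : ℕ) then a ((i : ℕ) + 1) else 0) *
      (if (j : ℕ) ≤ m then
        (a (m + 1) / a N) * ∏ k ∈ Finset.Icc (m + 2) N, (1 - a k / a ((j : ℕ) + 1))
      else 0)) N
  rw [hsum]
  have hIcc : Finset.Icc (j : ℕ) i ⊆ Finset.range N := by
    intro m hm
    simp only [Finset.mem_Icc, Finset.mem_range] at hm ⊢
    omega
  rw [← Finset.sum_subset hIcc (by
    intro m _ hm
    rw [Finset.mem_Icc, not_and_or] at hm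
    rcases hm with hm | hm <;> simp [hm])]
  split_ifs with hji
  · calc
      _ = ∑ m ∈ Finset.Icc (j : ℕ) i, a ((i : ℕ) + 1) / a N *
          (a (m + 1) * ∏ k ∈ Finset.Icc (m + 2) N, (1 - a k / a ((j : ℕ) + 1))) := by
        refine Finset.sum_congr rfl fun m hm => ?_
        obtain ⟨hjm, hmi⟩ := Finset.mem_Icc.mp hm
        rw [if_pos hmi, if_pos hjm]
        ring
      _ = _ := by
        rw [← Finset.mul_sum, sum_mul_prod_one_sub_div N a j hj i hji i.isLt]
        ring
  · rw [Finset.Icc_eq_empty hji, Finset.sum_empty, zero_mul]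
end

section
/- Let a_1, …, a_N be pairwise distinct nonzero real numbers. With D_a defined by d_{i,j} = (a_i/a_N) · ∏_{k=i+1}^{N} (1 − a_k/a_j) for i ≥ j (0 otherwise), and E_a defined by e_{i,j} = (a_N/a_i) · ∏_{k=j, k≠i}^{N} (1 − a_k/a_i)^{-1} for i ≥ j (0 otherwise), the index matrix satisfies the diagonalization S_a = D_a · diag(a_1, …, a_N) · E_a. -/
open Finset Matrix

/-- The matrix `E_a`: for 1-based indices `i ≥ j`,
`e_{i,j} = (a_N / a_i) ∏_{k=j, k≠i}^N (1 - a_k / a_i)⁻¹`, and `0` otherwise. -/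
noncomputable def Emat (N : ℕ) (a : ℕ → ℝ) : Matrix (Fin N) (Fin N) ℝ :=
  Matrix.of fun i j =>
    if (j : ℕ) ≤ (i : ℕ) then
      (a N / a ((i : ℕ) + 1)) *
        ∏ k ∈ (Finset.Icc ((j : ℕ) + 1) N).erase ((i : ℕ) + 1), (1 - a k / a ((i : ℕ) + 1))⁻¹
    else 0

/-- The Lagrange basis on the reciprocal nodes `(a k)⁻¹`, evaluated at `0`, sums to `1`. -/
theorem sum_prod_erase_inv_one_sub_div {ι K : Type*} [DecidableEq ι] [Field K] {s : Finset ι}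
    {a : ι → K} (hs : s.Nonempty) (hinj : Set.InjOn a s) (hne : ∀ i ∈ s, a i ≠ 0) :
    ∑ l ∈ s, ∏ k ∈ s.erase l, (1 - a k / a l)⁻¹ = 1 := by
  have hinv : Set.InjOn (fun i => (a i)⁻¹) s := fun x hx y hy h => hinj hx hy (inv_injective h)
  have h := congrArg (Polynomial.eval 0) (Lagrange.sum_basis hinv hs)
  rw [Polynomial.eval_finsetSum, Polynomial.eval_one] at h
  refine (Finset.sum_congr rfl fun l hl => ?_).trans h
  rw [Lagrange.basis, Polynomial.eval_prod]
  refine Finset.prod_congr rfl fun k hk => ?_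
  obtain ⟨hkl, hk⟩ := Finset.mem_erase.1 hk
  have hk0 := hne k hk
  have hl0 := hne l hl
  have hsub : a l - a k ≠ 0 := sub_ne_zero.2 fun e => hkl (hinj hk hl e.symm)
  have hsub' : a k - a l ≠ 0 := sub_ne_zero.2 fun e => hkl (hinj hk hl e)
  simp only [Lagrange.basisDivisor, Polynomial.eval_mul, Polynomial.eval_C, Polynomial.eval_sub,
    Polynomial.eval_X]
  rw [one_sub_div hl0, inv_sub_inv hl0 hk0]
  field_simp
  ring

/-- The factors with index beyond `i` cancel between `D_a` and `E_a`. -/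
theorem prod_Icc_mul_prod_erase_inv {K : Type*} [Field K] {N i j l : ℕ} {a : ℕ → K}
    (hji : j ≤ i) (hli : l ≤ i) (hiN : i ≤ N)
    (hne : ∀ k ∈ Finset.Icc (i + 1) N, 1 - a k / a l ≠ 0) :
    (∏ k ∈ Finset.Icc (i + 1) N, (1 - a k / a l)) *
        ∏ k ∈ (Finset.Icc j N).erase l, (1 - a k / a l)⁻¹ =
      ∏ k ∈ (Finset.Icc j i).erase l, (1 - a k / a l)⁻¹ := by
  have hunion : (Finset.Icc j N).erase l = (Finset.Icc j i).erase l ∪ Finset.Icc (i + 1) N := by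
    ext k
    simp only [Finset.mem_erase, Finset.mem_Icc, Finset.mem_union]
    omega
  have hdisj : Disjoint ((Finset.Icc j i).erase l) (Finset.Icc (i + 1) N) := by
    rw [Finset.disjoint_left]
    intro k
    simp only [Finset.mem_erase, Finset.mem_Icc]
    omega
  rw [hunion, Finset.prod_union hdisj, mul_left_comm, ← Finset.prod_mul_distrib,
    Finset.prod_eq_one fun k hk => mul_inv_cancel₀ (hne k hk), mul_one]

theorem stmt_10 (N : ℕ) (a : ℕ → ℝ)
    (hdist : Set.InjOn a (Set.Icc 1 N)) (hne : ∀ n ∈ Finset.Icc 1 N, a n ≠ 0) :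
    idxS N a
      = Dmat N a * Matrix.diagonal (fun i : Fin N => a ((i : ℕ) + 1)) * Emat N a := by
  ext ⟨i, hi⟩ ⟨j, hj⟩
  let f : ℕ → ℝ := fun l => if j ≤ l ∧ l ≤ i then
    a (i + 1) * ∏ k ∈ (Finset.Icc (j + 1) (i + 1)).erase (l + 1), (1 - a k / a (l + 1))⁻¹ else 0
  have hterm : ∀ l : Fin N,
      (Dmat N a * Matrix.diagonal (fun i : Fin N => a ((i : ℕ) + 1))) ⟨i, hi⟩ l *
          Emat N a l ⟨j, hj⟩ = f l := by
    rintro ⟨l, hl⟩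
    simp only [Matrix.mul_diagonal, Dmat, Emat, Matrix.of_apply, f]
    by_cases hli : l ≤ i
    · by_cases hjl : j ≤ l
      · have hl0 : a (l + 1) ≠ 0 := hne _ (Finset.mem_Icc.2 ⟨by omega, hl⟩)
        have hN0 : a N ≠ 0 := hne _ (Finset.mem_Icc.2 ⟨by omega, le_rfl⟩)
        rw [if_pos hli, if_pos hjl, if_pos ⟨hjl, hli⟩,
          ← prod_Icc_mul_prod_erase_inv (N := N) (by omega) (by omega) hi]
        · field_simp
        · intro k hk h
          rw [Finset.mem_Icc] at hk
          rw [sub_eq_zero, eq_comm, div_eq_one_iff_eq hl0] at h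
          have := hdist ⟨by omega, hk.2⟩ ⟨by omega, hl⟩ h
          omega
      · simp [hjl]
    · simp [hli]
  rw [Matrix.mul_apply, Finset.sum_congr rfl fun l _ => hterm l, Fin.sum_univ_eq_sum_range f,
    ← Finset.sum_filter, ← Finset.mul_sum]
  simp only [idxS, Matrix.of_apply]
  split_ifs with hji
  · have hreindex : ∑ l ∈ Finset.range N with j ≤ l ∧ l ≤ i,
        ∏ k ∈ (Finset.Icc (j + 1) (i + 1)).erase (l + 1), (1 - a k / a (l + 1))⁻¹ =
        ∑ l ∈ Finset.Icc (j + 1) (i + 1),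
          ∏ k ∈ (Finset.Icc (j + 1) (i + 1)).erase l, (1 - a k / a l)⁻¹ := by
      refine Finset.sum_nbij (· + 1) ?_ (fun _ _ _ _ h => Nat.succ_injective h) ?_ fun _ _ => rfl
      · intro l
        simp only [Finset.mem_filter, Finset.mem_range, Finset.mem_Icc]
        omega
      · intro l hl
        rw [Finset.mem_coe, Finset.mem_Icc] at hl
        refine ⟨l - 1, ?_, by grind⟩
        simp only [Finset.coe_filter, Finset.mem_range, Set.mem_ofPred_eq]
        omega
    rw [hreindex, sum_prod_erase_inv_one_sub_div, mul_one]
    · exact Finset.nonempty_Icc.2 (by omega)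
    · refine hdist.mono fun k hk => ?_
      rw [Finset.mem_coe, Finset.mem_Icc] at hk
      exact ⟨by omega, by omega⟩
    · intro k hk
      rw [Finset.mem_Icc] at hk
      exact hne k (Finset.mem_Icc.2 ⟨by omega, by omega⟩)
  · rw [Finset.filter_false_of_mem fun l _ h => hji (h.1.trans h.2), Finset.sum_empty, mul_zero]
end

section
/- Let a_1, …, a_N be pairwise distinct nonzero real numbers and let k ≥ 0 be an integer. With D_a and E_a as in the diagonalization of the index matrix S_a (d_{i,j} = (a_i/a_N)∏_{k'=i+1}^{N}(1 − a_{k'}/a_j) and e_{i,j} = (a_N/a_i)∏_{k'=j, k'≠i}^{N}(1 − a_{k'}/a_i)^{-1} for i ≥ j, 0 otherwise), the k-th power satisfies (S_a)^k = D_a · diag(a_1^k, …, a_N^k) · E_a. -/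
open Finset Matrix

theorem sum_fin_ite_Ico {N : ℕ} (i j : Fin N) (f : ℕ → ℝ) :
    ∑ m : Fin N, (if (j : ℕ) ≤ m ∧ (m : ℕ) ≤ i then f m else 0)
      = ∑ m ∈ Finset.Ico (j : ℕ) (i + 1), f m := by
  rw [Fin.sum_univ_eq_sum_range (fun m => if (j : ℕ) ≤ m ∧ m ≤ (i : ℕ) then f m else 0) N,
    ← Finset.sum_filter]
  refine Finset.sum_congr ?_ fun _ _ => rfl
  ext m
  have := i.2
  simp only [Finset.mem_filter, Finset.mem_range, Finset.mem_Ico]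
  omega

theorem ratio_ne_one {N : ℕ} {a : ℕ → ℝ} (hdist : Set.InjOn a (Set.Icc 1 N))
    (hne : ∀ n ∈ Finset.Icc 1 N, a n ≠ 0) {m n : ℕ} (hm : m ∈ Finset.Icc 1 N)
    (hn : n ∈ Finset.Icc 1 N) (hmn : m ≠ n) : 1 - a m / a n ≠ 0 := by
  intro h
  have h1 : a m / a n = 1 := by linarith
  rw [div_eq_one_iff_eq (hne n hn)] at h1
  exact hmn (hdist (by simpa using hm) (by simpa using hn) h1)

theorem idxS_mul_Dmat {N : ℕ} {a : ℕ → ℝ} (hne : ∀ n ∈ Finset.Icc 1 N, a n ≠ 0) :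
    idxS N a * Dmat N a
      = Dmat N a * Matrix.diagonal (fun i : Fin N => a ((i : ℕ) + 1)) := by
  ext i j
  have hi := i.2
  have hj := j.2
  have haj : a (j + 1) ≠ 0 := hne _ (Finset.mem_Icc.2 (by omega))
  have haN : a N ≠ 0 := hne _ (Finset.mem_Icc.2 (by omega))
  rw [Matrix.mul_diagonal, Matrix.mul_apply]
  let P : ℕ → ℝ := fun m => ∏ k ∈ Finset.Icc (m + 1) N, (1 - a k / a (j + 1))
  have hP : ∀ m < N, P m = (1 - a (m + 1) / a (j + 1)) * P (m + 1) := fun m hm => by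
    simp only [P]
    rw [← Finset.mul_prod_Ioc_eq_prod_Icc (by omega : m + 1 ≤ N),
      ← Finset.Icc_add_one_left_eq_Ioc]
  have hPj : P j = 0 := by rw [hP j hj, div_self haj]; simp
  calc ∑ m, idxS N a i m * Dmat N a m j
      = ∑ m : Fin N, (if (j : ℕ) ≤ m ∧ (m : ℕ) ≤ i then
          a (i + 1) * (a (m + 1) / a N * P (m + 1)) else 0) := by
        refine Finset.sum_congr rfl fun m _ => ?_
        simp only [idxS, Dmat, Matrix.of_apply, P]
        split_ifs <;> first | rfl | omega | simp
    _ = ∑ m ∈ Finset.Ico (j : ℕ) (i + 1), a (i + 1) * (a (m + 1) / a N * P (m + 1)) :=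
        sum_fin_ite_Ico i j fun m => a (i + 1) * (a (m + 1) / a N * P (m + 1))
    _ = ∑ m ∈ Finset.Ico (j : ℕ) (i + 1),
          a (i + 1) * a (j + 1) / a N * (P (m + 1) - P m) := by
        refine Finset.sum_congr rfl fun m hm => ?_
        rw [Finset.mem_Ico] at hm
        rw [hP m (by omega)]
        field_simp
        ring
    _ = Dmat N a i j * a (j + 1) := by
        rw [← Finset.mul_sum]
        simp only [Dmat, Matrix.of_apply]
        split_ifs with h
        · rw [Finset.sum_Ico_sub P (by omega), hPj]
          simp only [P]
          ring
        · rw [Finset.Ico_eq_empty (by omega)]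
          simp

theorem Emat_mul_idxS {N : ℕ} {a : ℕ → ℝ} (hdist : Set.InjOn a (Set.Icc 1 N))
    (hne : ∀ n ∈ Finset.Icc 1 N, a n ≠ 0) :
    Emat N a * idxS N a
      = Matrix.diagonal (fun i : Fin N => a ((i : ℕ) + 1)) * Emat N a := by
  ext i j
  have hi := i.2
  have hai : a (i + 1) ≠ 0 := hne _ (Finset.mem_Icc.2 (by omega))
  rw [Matrix.diagonal_mul, Matrix.mul_apply]
  let Q : ℕ → ℝ := fun m =>
    ∏ k ∈ (Finset.Icc (m + 1) N).erase (i + 1), (1 - a k / a (i + 1))⁻¹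
  have hQ : ∀ m < (i : ℕ), Q (m + 1) = (1 - a (m + 1) / a (i + 1)) * Q m := fun m hm => by
    have hs : (Finset.Icc (m + 1) N).erase ((i : ℕ) + 1)
        = insert (m + 1) ((Finset.Icc (m + 1 + 1) N).erase ((i : ℕ) + 1)) := by
      ext k
      simp only [Finset.mem_erase, Finset.mem_insert, Finset.mem_Icc]
      omega
    simp only [Q]
    rw [hs, Finset.prod_insert (by simp), mul_inv_cancel_left₀]
    exact ratio_ne_one hdist hne (Finset.mem_Icc.2 (by omega)) (Finset.mem_Icc.2 (by omega)) (by omega)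
  calc ∑ m, Emat N a i m * idxS N a m j
      = ∑ m : Fin N, (if (j : ℕ) ≤ m ∧ (m : ℕ) ≤ i then
          a N / a (i + 1) * Q m * a (m + 1) else 0) := by
        refine Finset.sum_congr rfl fun m _ => ?_
        simp only [idxS, Emat, Matrix.of_apply, Q]
        split_ifs <;> first | rfl | omega | simp
    _ = ∑ m ∈ Finset.Ico (j : ℕ) (i + 1), a N / a (i + 1) * Q m * a (m + 1) :=
        sum_fin_ite_Ico i j fun m => a N / a (i + 1) * Q m * a (m + 1)
    _ = a (i + 1) * Emat N a i j := by
        simp only [Emat, Matrix.of_apply]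
        split_ifs with h
        · have hsum : ∑ m ∈ Finset.Ico (j : ℕ) i, a N / a (i + 1) * Q m * a (m + 1)
              = ∑ m ∈ Finset.Ico (j : ℕ) i, -a N * (Q (m + 1) - Q m) := by
            refine Finset.sum_congr rfl fun m hm => ?_
            rw [hQ m (Finset.mem_Ico.1 hm).2]
            field_simp
            ring
          rw [Finset.sum_Ico_succ_top h, hsum, ← Finset.mul_sum, Finset.sum_Ico_sub Q h]
          change _ = a (i + 1) * (a N / a (i + 1) * Q j)
          field_simp
          ring
        · rw [Finset.Ico_eq_empty (by omega)]
          simp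

theorem Emat_mul_Dmat_apply_self {N : ℕ} {a : ℕ → ℝ} (hdist : Set.InjOn a (Set.Icc 1 N))
    (hne : ∀ n ∈ Finset.Icc 1 N, a n ≠ 0) (i : Fin N) :
    (Emat N a * Dmat N a) i i = 1 := by
  have hi := i.2
  have hai : a (i + 1) ≠ 0 := hne _ (Finset.mem_Icc.2 (by omega))
  have haN : a N ≠ 0 := hne _ (Finset.mem_Icc.2 (by omega))
  rw [Matrix.mul_apply, Finset.sum_eq_single i]
  · have hs : (Finset.Icc ((i : ℕ) + 1) N).erase ((i : ℕ) + 1) = Finset.Icc ((i : ℕ) + 2) N := by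
      ext k
      simp only [Finset.mem_erase, Finset.mem_Icc]
      omega
    simp only [Emat, Dmat, Matrix.of_apply, le_refl, if_true, hs, Finset.prod_inv_distrib]
    have hp : ∏ k ∈ Finset.Icc ((i : ℕ) + 2) N, (1 - a k / a (i + 1)) ≠ 0 := by
      refine Finset.prod_ne_zero_iff.2 fun k hk => ?_
      rw [Finset.mem_Icc] at hk
      exact ratio_ne_one hdist hne (Finset.mem_Icc.2 (by omega)) (Finset.mem_Icc.2 (by omega)) (by omega)
    generalize ∏ k ∈ Finset.Icc ((i : ℕ) + 2) N, (1 - a k / a (i + 1)) = p at hp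
    field_simp
  · intro m _ hm
    have := Fin.val_ne_of_ne hm
    simp only [Emat, Dmat, Matrix.of_apply]
    split_ifs <;> first | omega | simp
  · simp

theorem Emat_mul_Dmat {N : ℕ} {a : ℕ → ℝ} (hdist : Set.InjOn a (Set.Icc 1 N))
    (hne : ∀ n ∈ Finset.Icc 1 N, a n ≠ 0) : Emat N a * Dmat N a = 1 := by
  have hcomm : (Emat N a * Dmat N a) * Matrix.diagonal (fun i : Fin N => a ((i : ℕ) + 1))
      = Matrix.diagonal (fun i : Fin N => a ((i : ℕ) + 1)) * (Emat N a * Dmat N a) := by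
    rw [Matrix.mul_assoc, ← idxS_mul_Dmat hne, ← Matrix.mul_assoc, Emat_mul_idxS hdist hne,
      Matrix.mul_assoc]
  ext i j
  obtain rfl | hij := eq_or_ne i j
  · rw [Emat_mul_Dmat_apply_self hdist hne, Matrix.one_apply_eq]
  · have h := congrFun (congrFun hcomm i) j
    rw [Matrix.mul_diagonal, Matrix.diagonal_mul, mul_comm] at h
    rw [Matrix.one_apply_ne hij]
    have hi := i.2
    have hj := j.2
    by_contra h0
    have := hdist (Set.mem_Icc.2 (by omega)) (Set.mem_Icc.2 (by omega)) (mul_right_cancel₀ h0 h)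
    exact hij (Fin.ext (by omega))

theorem stmt_11 (N : ℕ) (a : ℕ → ℝ) (k : ℕ)
    (hdist : Set.InjOn a (Set.Icc 1 N)) (hne : ∀ n ∈ Finset.Icc 1 N, a n ≠ 0) :
    idxS N a ^ k
      = Dmat N a * Matrix.diagonal (fun i : Fin N => a ((i : ℕ) + 1) ^ k) * Emat N a := by
  have hpow : idxS N a ^ k * Dmat N a
      = Dmat N a * Matrix.diagonal (fun i : Fin N => a ((i : ℕ) + 1) ^ k) := by
    induction k with
    | zero => simp
    | succ k ih =>
      rw [pow_succ, Matrix.mul_assoc, idxS_mul_Dmat hne, ← Matrix.mul_assoc, ih,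
        Matrix.mul_assoc, Matrix.diagonal_mul_diagonal]
      simp only [pow_succ]
  rw [← hpow, Matrix.mul_assoc, mul_eq_one_comm.1 (Emat_mul_Dmat hdist hne), mul_one]
end
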